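/- Let g1 and g2 be vectors in a real inner product space with ‖g1‖ = ‖g2‖, let g0 = (1/2)(g1 + g2), let c ∈ [0,1), and set φ = c²·‖g0‖². Define F(w) = ⟨w·g1 + (1−w)·g2, g0⟩ + √φ · ‖w·g1 + (1−w)·g2‖ for w ∈ [0,1]. Then F(1/2) ≤ F(w) for all w ∈ [0,1]; i.e., the CAGrad objective over the two-task simplex is minimized by the equal weights (1/2, 1/2). -/

import Mathlib

open scoped RealInnerProductSpace

/-- The CAGrad objective `F(w) = ⟪g_w, g0⟫ + √φ·‖g_w‖` over the two-task
simplex, where `g_w = w•g1 + (1−w)•g2`, `g0 = (1/2)(g1+g2)`, `φ = c²‖g0‖²`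
and `‖g1‖ = ‖g2‖`, is minimized at equal weights `w = 1/2`. -/
theorem cagrad_objective_min_at_equal_weights
    {E : Type*} [NormedAddCommGroup E] [InnerProductSpace ℝ E]
    (g1 g2 : E) (h : ‖g1‖ = ‖g2‖)
    (g0 : E) (hg0 : g0 = (1/2 : ℝ) • (g1 + g2))
    (c : ℝ) (hc : c ∈ Set.Ico (0 : ℝ) 1)
    (φ : ℝ) (hφ : φ = c ^ 2 * ‖g0‖ ^ 2)
    (F : ℝ → ℝ)
    (hF : ∀ w, F w = ⟪w • g1 + (1 - w) • g2, g0⟫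
        + Real.sqrt φ * ‖w • g1 + (1 - w) • g2‖) :
    ∀ w ∈ Set.Icc (0 : ℝ) 1, F (1/2) ≤ F w := by
  intro w _
  have horth : ⟪g1 - g2, g0⟫ = 0 := by
    rw [hg0, real_inner_smul_right, real_inner_comm,
      (real_inner_add_sub_eq_zero_iff g1 g2).2 h, mul_zero]
  have hmid : (1 / 2 : ℝ) • g1 + (1 - 1 / 2 : ℝ) • g2 = g0 := by
    rw [hg0]; module
  have hw : w • g1 + (1 - w) • g2 = g0 + (w - 1 / 2) • (g1 - g2) := by
    rw [hg0]; module
  have hinner : ⟪g0 + (w - 1 / 2) • (g1 - g2), g0⟫ = ⟪g0, g0⟫ := by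
    rw [inner_add_left, real_inner_smul_left, horth, mul_zero, add_zero]
  have hnorm : ‖g0‖ ≤ ‖g0 + (w - 1 / 2) • (g1 - g2)‖ := by
    refine abs_le_of_sq_le_sq' ?_ (norm_nonneg _) |>.2
    rw [norm_add_sq_real, real_inner_smul_right, real_inner_comm, horth]
    nlinarith [sq_nonneg ‖(w - 1 / 2) • (g1 - g2)‖]
  rw [hF, hF, hmid, hw, hinner]
  gcongr
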